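/- Let φ : [0,1] → ℝ be C² with 0 < c ≤ |φ''(x)| ≤ C' for all x ∈ [0,1]. Fix t ≠ 0, T > 0, and a Schwartz function f whose Fourier transform f̂ is compactly supported. For N ∈ ℕ and α, β ∈ ℝ define ρ^{(N)}_{t,α,β}(f) = (1/N²) Σ_{ℓ∈ℤ} f̂(2πℓ/N) |Σ_{j=1}^N exp(i t ℓ N (α φ(j/N) + β j/N))|². Then there is a constant C such that for all N ≥ 2, (1/(2T)²) ∫_{−T}^{T} ∫_{−T}^{T} | ρ^{(N)}_{t,α,β}(f) − (f(0) + f̂(0)) |² dα dβ ≤ C (log N)³ / N. -/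

import Mathlib

open MeasureTheory Filter Topology Real

/-- Fourier transform with the convention `f̂(ξ) = ∫ f(x) e^{-i x ξ} dx`. -/
noncomputable def FT (f : ℝ → ℝ) (ξ : ℝ) : ℂ :=
  ∫ x : ℝ, (f x : ℂ) * Complex.exp (-(Complex.I * x * ξ))

open scoped FourierTransform SchwartzMap ContDiff in
/-- A nonnegative bump of support radius `r` whose Fourier transform stays away from zero on
`[-T, T]`. -/
theorem exists_schwartz_bump (r T : ℝ) (hr : 0 < r) (hrT : 2 * π * r * T ≤ 1) :
    ∃ g : 𝓢(ℝ, ℂ), (∀ v, ‖g v‖ ≤ 1) ∧ (∀ v, r ≤ |v| → g v = 0) ∧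
      ∃ κ : ℝ, 0 < κ ∧ ∀ w, |w| ≤ T → κ ≤ ‖𝓕 (g : ℝ → ℂ) w‖ := by
  let b : ContDiffBump (0 : ℝ) := ⟨r / 2, r, by positivity, by linarith⟩
  have hbs : HasCompactSupport (fun v => ((b v : ℝ) : ℂ)) :=
    b.hasCompactSupport.comp_left (g := fun x : ℝ => (x : ℂ)) (by simp)
  have hbc : ContDiff ℝ ∞ (fun v => ((b v : ℝ) : ℂ)) :=
    Complex.ofRealCLM.contDiff.comp b.contDiff
  have hz : ∀ v, r ≤ |v| → b v = 0 := fun v hv =>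
    b.zero_of_le_dist (by simpa [Real.dist_eq, b] using hv)
  refine ⟨hbs.toSchwartzMap hbc, fun v => ?_, fun v hv => ?_, (∫ v, b v) / 2, ?_, fun w hw => ?_⟩
  · simpa [abs_of_nonneg b.nonneg] using b.le_one
  · simp [hz v hv]
  · have := b.integral_pos (μ := volume)
    positivity
  · have hexp : ∀ v : ℝ, Complex.exp (↑(-2 * π * v * w) * Complex.I) • ((b v : ℝ) : ℂ)
        = Complex.exp (↑(-2 * π * v * w) * Complex.I) * ((b v : ℝ) : ℂ) := fun v => rfl
    have hint : Integrable
        (fun v : ℝ => Complex.exp (↑(-2 * π * v * w) * Complex.I) * ((b v : ℝ) : ℂ)) :=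
      Continuous.integrable_of_hasCompactSupport
        (by have := b.continuous; fun_prop) hbs.mul_left
    have hre : (𝓕 (fun v => ((b v : ℝ) : ℂ)) w).re = ∫ v, Real.cos (2 * π * v * w) * b v := by
      rw [Real.fourier_real_eq_integral_exp_smul]
      simp only [smul_eq_mul]
      have h := integral_re hint
      simp only [RCLike.re_to_complex] at h
      rw [← h]
      congr 1
      ext v
      rw [Complex.re_mul_ofReal, Complex.exp_ofReal_mul_I_re, ← Real.cos_neg]
      ring_nf
    have hle : (∫ v, b v) / 2 ≤ ∫ v, Real.cos (2 * π * v * w) * b v := by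
      rw [← integral_div]
      refine integral_mono (b.integrable.div_const 2) ?_ fun v => ?_
      · exact Continuous.integrable_of_hasCompactSupport
          (by have := b.continuous; fun_prop) b.hasCompactSupport.mul_left
      · by_cases hv : r ≤ |v|
        · simp [hz v hv]
        · push Not at hv
          have h1 : |2 * π * v * w| ≤ 1 := by
            rw [abs_mul, abs_mul, abs_of_pos Real.two_pi_pos]
            refine le_trans ?_ hrT
            have := Real.two_pi_pos
            gcongr
          have h2 := Real.one_sub_sq_div_two_le_cos (x := 2 * π * v * w)
          have h3 : (2 * π * v * w) ^ 2 ≤ 1 := by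
            rw [← sq_abs]
            exact pow_le_one₀ (abs_nonneg _) h1
          have := b.nonneg' v
          show b v / 2 ≤ _ * b v
          nlinarith
    calc _ ≤ _ := hle
      _ = _ := hre.symm
      _ ≤ _ := (Complex.re_le_norm _)

open scoped FourierTransform SchwartzMap in
/-- A Gallagher-type mean value estimate for exponential sums with arbitrary real frequencies. -/
theorem exists_integral_norm_sq_expSum_le (T δ : ℝ) (hT : 0 < T) (hδ : 0 < δ) :
    ∃ K : ℝ, 0 ≤ K ∧ ∀ (ι : Type) (s : Finset ι) (a : ι → ℂ) (x : ι → ℝ),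
      ∫ u in (-T)..T, ‖∑ i ∈ s, a i * Complex.exp (Complex.I * ((x i * u : ℝ) : ℂ))‖ ^ 2
        ≤ K * ∑ i ∈ s, ∑ j ∈ s, if |x i - x j| ≤ δ then ‖a i‖ * ‖a j‖ else 0 := by
  have hpi := Real.two_pi_pos
  set r : ℝ := min (1 / (2 * π * T)) (δ / (2 * π) / 2) with hr_def
  have hr : 0 < r := lt_min (by positivity) (by positivity)
  have hrT : 2 * π * r * T ≤ 1 := by
    calc 2 * π * r * T ≤ 2 * π * (1 / (2 * π * T)) * T := by
          gcongr; exact min_le_left _ _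
      _ = 1 := by field_simp
  have hrδ : 2 * r ≤ δ / (2 * π) := by
    have := min_le_right (1 / (2 * π * T)) (δ / (2 * π) / 2)
    linarith
  obtain ⟨g, hg1, hg0, κ, hκ, hgκ⟩ := exists_schwartz_bump r T hr hrT
  refine ⟨(∫ v, ‖g v‖) / κ ^ 2, by positivity, fun ι s a x => ?_⟩
  let b : ι → ℝ := fun i => -(x i / (2 * π))
  let G : 𝓢(ℝ, ℂ) := ∑ i ∈ s, a i • g.compSubConstCLM ℂ (b i)
  have hG : ∀ v, G v = ∑ i ∈ s, a i * g (v - b i) := by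
    intro v
    simp [G]
  have hFG : ∀ w : ℝ, 𝓕 (G : ℝ → ℂ) w =
      (∑ i ∈ s, a i * Complex.exp (Complex.I * ((x i * w : ℝ) : ℂ))) * 𝓕 (g : ℝ → ℂ) w := by
    intro w
    rw [Real.fourier_real_eq_integral_exp_smul, Real.fourier_real_eq_integral_exp_smul,
      Finset.sum_mul]
    simp_rw [hG, smul_eq_mul, Finset.mul_sum]
    rw [integral_finsetSum]
    · refine Finset.sum_congr rfl fun i _ => ?_
      rw [mul_assoc, ← integral_const_mul, ← integral_const_mul,
        ← integral_sub_right_eq_self (fun v => a i * _) (b i)]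
      refine integral_congr_ae (ae_of_all _ fun v => ?_)
      simp only
      rw [← mul_assoc (Complex.exp _) (Complex.exp _), ← Complex.exp_add]
      rw [mul_left_comm]
      congr 3
      simp only [b]
      push_cast
      field_simp
      ring
    · intro i _
      have hi : Integrable (fun v => a i * g (v - b i)) :=
        (g.integrable.comp_sub_right (b i)).const_mul _
      refine (hi.bdd_mul (c := 1) ?_ ?_)
      · exact Continuous.aestronglyMeasurable (by fun_prop)
      · exact ae_of_all _ fun v => by rw [Complex.norm_exp_ofReal_mul_I]
  have hGle : ∀ v, ‖G v‖ ^ 2 ≤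
      ∑ i ∈ s, ∑ j ∈ s, (if |x i - x j| ≤ δ then ‖a i‖ * ‖a j‖ else 0) * ‖g (v - b i)‖ := by
    intro v
    rw [hG]
    calc ‖∑ i ∈ s, a i * g (v - b i)‖ ^ 2
        ≤ (∑ i ∈ s, ‖a i * g (v - b i)‖) ^ 2 := by gcongr; exact norm_sum_le _ _
      _ = ∑ i ∈ s, ∑ j ∈ s, ‖a i * g (v - b i)‖ * ‖a j * g (v - b j)‖ := by
          rw [sq, Finset.sum_mul_sum]
      _ ≤ _ := by
          refine Finset.sum_le_sum fun i _ => Finset.sum_le_sum fun j _ => ?_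
          rw [norm_mul, norm_mul]
          split_ifs with hij
          · calc ‖a i‖ * ‖g (v - b i)‖ * (‖a j‖ * ‖g (v - b j)‖)
                = ‖a i‖ * ‖a j‖ * ‖g (v - b i)‖ * ‖g (v - b j)‖ := by ring
              _ ≤ ‖a i‖ * ‖a j‖ * ‖g (v - b i)‖ * 1 := by gcongr; exact hg1 _
              _ = _ := mul_one _
          · have : r ≤ |v - b i| ∨ r ≤ |v - b j| := by
              by_contra! h
              apply hij
              have h1 : |b i - b j| ≤ 2 * r := by
                have := abs_sub (v - b j) (v - b i)
                rw [show v - b j - (v - b i) = b i - b j by ring] at this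
                linarith
              have h2 : |b i - b j| = |x i - x j| / (2 * π) := by
                rw [show b i - b j = -((x i - x j) / (2 * π)) by simp only [b]; ring, abs_neg,
                  abs_div, abs_of_pos hpi]
              rw [h2] at h1
              have h3 := h1.trans hrδ
              rwa [div_le_div_iff_of_pos_right hpi] at h3
            rcases this with h | h <;> simp [hg0 _ h]
  have hPl : ∫ w, ‖𝓕 (G : ℝ → ℂ) w‖ ^ 2 = ∫ v, ‖G v‖ ^ 2 := SchwartzMap.integral_norm_sq_fourier G
  have hint : Integrable (fun w => ‖𝓕 (G : ℝ → ℂ) w‖ ^ 2) :=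
    ((𝓕 G).memLp 2 volume).integrable_norm_pow (by norm_num)
  have hintG : Integrable (fun w => ‖G w‖ ^ 2) :=
    (G.memLp 2 volume).integrable_norm_pow (by norm_num)
  have hgn : ∀ i, Integrable (fun v => ‖g (v - b i)‖) := fun i =>
    (g.integrable.comp_sub_right (b i)).norm
  have hupper : ∫ v, ‖G v‖ ^ 2 ≤
      (∫ v, ‖g v‖) * ∑ i ∈ s, ∑ j ∈ s, if |x i - x j| ≤ δ then ‖a i‖ * ‖a j‖ else 0 := by
    calc ∫ v, ‖G v‖ ^ 2 ≤ ∫ v, ∑ i ∈ s, ∑ j ∈ s,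
          (if |x i - x j| ≤ δ then ‖a i‖ * ‖a j‖ else 0) * ‖g (v - b i)‖ :=
          integral_mono hintG (integrable_finsetSum _ fun i _ => integrable_finsetSum _ fun j _ =>
            (hgn i).const_mul _) hGle
      _ = _ := by
          rw [integral_finsetSum _ fun i _ => integrable_finsetSum _ fun j _ =>
            (hgn i).const_mul _, Finset.mul_sum]
          refine Finset.sum_congr rfl fun i _ => ?_
          rw [integral_finsetSum _ fun j _ => (hgn i).const_mul _, Finset.mul_sum]
          refine Finset.sum_congr rfl fun j _ => ?_
          rw [integral_const_mul, integral_sub_right_eq_self (fun v => ‖g v‖), mul_comm]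
  rw [div_mul_eq_mul_div, le_div_iff₀ (by positivity)]
  refine le_trans ?_ hupper
  rw [← hPl, intervalIntegral.integral_of_le (by linarith), ← integral_mul_const]
  refine le_trans ?_ (setIntegral_le_integral (s := Set.Ioc (-T) T) hint
    (ae_of_all _ fun w => by positivity))
  refine setIntegral_mono_on ?_ hint.integrableOn measurableSet_Ioc fun w hw => ?_
  · exact (Continuous.integrableOn_Icc (by fun_prop)).mono_set Set.Ioc_subset_Icc_self
  · rw [hFG, norm_mul, mul_pow]
    gcongr
    exact hgκ w (abs_le.2 ⟨hw.1.le, hw.2⟩)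

theorem ConvexOn.sub_le_sub_of_translate {s : Set ℝ} {χ : ℝ → ℝ} (hχ : ConvexOn ℝ s χ) {x y h : ℝ}
    (hx : x ∈ s) (hy : y + h ∈ s) (hxy : x ≤ y) (hh : 0 < h) :
    χ (x + h) - χ x ≤ χ (y + h) - χ y := by
  have hd : 0 < y - x + h := by linarith
  have hp : 0 ≤ h / (y - x + h) := by positivity
  have hq : 0 ≤ (y - x) / (y - x + h) := div_nonneg (by linarith) hd.le
  have h1 := hχ.2 hx hy hp hq (by field_simp; ring)
  have h2 := hχ.2 hx hy hq hp (by field_simp)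
  simp only [smul_eq_mul] at h1 h2
  rw [show h / (y - x + h) * x + (y - x) / (y - x + h) * (y + h) = y by field_simp; ring] at h1
  rw [show (y - x) / (y - x + h) * x + h / (y - x + h) * (y + h) = x + h by
    field_simp; ring] at h2
  have h3 : h / (y - x + h) * χ x + (y - x) / (y - x + h) * χ (y + h)
      + ((y - x) / (y - x + h) * χ x + h / (y - x + h) * χ (y + h)) = χ x + χ (y + h) := by
    field_simp
    ring
  linarith

/-- If `φ'' ≥ c` on `[0, 1]`, then `φ - c x² / 2` is convex there. -/
theorem convexOn_sub_sq_of_iteratedDerivWithin_ge {φ : ℝ → ℝ} {c : ℝ}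
    (hφ : ContDiffOn ℝ 2 φ (Set.Icc 0 1))
    (hφ'' : ∀ x ∈ Set.Icc (0 : ℝ) 1, c ≤ iteratedDerivWithin 2 φ (Set.Icc 0 1) x) :
    ConvexOn ℝ (Set.Icc 0 1) fun x => φ x - c / 2 * x ^ 2 := by
  have hcd : ContDiffOn ℝ 2 (fun x => φ x - c / 2 * x ^ 2) (Set.Icc 0 1) :=
    hφ.sub (by fun_prop)
  have hcd' : ContDiffOn ℝ 2 (fun x => φ x - c / 2 * x ^ 2) (Set.Ioo 0 1) :=
    hcd.mono Set.Ioo_subset_Icc_self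
  refine convexOn_of_deriv2_nonneg (convex_Icc 0 1) hcd.continuousOn ?_ ?_ fun x hx => ?_
  · rw [interior_Icc]
    exact hcd'.differentiableOn (by norm_num)
  · rw [interior_Icc]
    exact (hcd'.deriv_of_isOpen isOpen_Ioo (m := 1) (by norm_num)).differentiableOn (by norm_num)
  · rw [interior_Icc] at hx
    have hxI := Set.Ioo_subset_Icc_self hx
    have hφx : ContDiffAt ℝ 2 φ x := hφ.contDiffAt (Icc_mem_nhds hx.1 hx.2)
    have h1 := hφ'' x hxI
    rw [iteratedDerivWithin_eq_iteratedDeriv (uniqueDiffOn_Icc zero_lt_one) hφx hxI] at h1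
    rw [← iteratedDeriv_eq_iterate]
    have h2 : iteratedDeriv 2 (fun x => φ x - c / 2 * x ^ 2) x = iteratedDeriv 2 φ x - c := by
      rw [show (fun x => φ x - c / 2 * x ^ 2) = φ - fun x => c / 2 * x ^ 2 from rfl,
        iteratedDeriv_sub hφx (by fun_prop), iteratedDeriv_const_mul_field]
      simp [iteratedDeriv_succ]
    rw [h2]
    linarith

theorem le_abs_sub_sub_sub_of_iteratedDerivWithin_ge {φ : ℝ → ℝ} {c : ℝ}
    (hφ : ContDiffOn ℝ 2 φ (Set.Icc 0 1))
    (hφ'' : ∀ x ∈ Set.Icc (0 : ℝ) 1, c ≤ iteratedDerivWithin 2 φ (Set.Icc 0 1) x)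
    {x y h : ℝ} (hx : x ∈ Set.Icc (0 : ℝ) 1) (hy : y ∈ Set.Icc (0 : ℝ) 1)
    (hxh : x + h ∈ Set.Icc (0 : ℝ) 1) (hyh : y + h ∈ Set.Icc (0 : ℝ) 1) :
    c * |h| * |x - y| ≤ |(φ (x + h) - φ x) - (φ (y + h) - φ y)| := by
  have hconv := convexOn_sub_sq_of_iteratedDerivWithin_ge hφ hφ''
  have key : ∀ x y h : ℝ, x ∈ Set.Icc (0 : ℝ) 1 → y + h ∈ Set.Icc (0 : ℝ) 1 → x ≤ y → 0 < h →
      c * |h| * |x - y| ≤ |(φ (x + h) - φ x) - (φ (y + h) - φ y)| := by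
    intro x y h hx hy hxy hh
    have := hconv.sub_le_sub_of_translate hx hy hxy hh
    rw [abs_of_pos hh, abs_of_nonpos (sub_nonpos.2 hxy), abs_sub_comm]
    refine le_trans ?_ (le_abs_self _)
    nlinarith
  have key2 : ∀ x y h : ℝ, x ∈ Set.Icc (0 : ℝ) 1 → y ∈ Set.Icc (0 : ℝ) 1 →
      x + h ∈ Set.Icc (0 : ℝ) 1 → y + h ∈ Set.Icc (0 : ℝ) 1 → 0 < h →
      c * |h| * |x - y| ≤ |(φ (x + h) - φ x) - (φ (y + h) - φ y)| := by
    intro x y h hx hy hxh hyh hh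
    rcases le_total x y with hxy | hxy
    · exact key x y h hx hyh hxy hh
    · rw [abs_sub_comm x y, abs_sub_comm (φ (x + h) - φ x)]
      exact key y x h hy hxh hxy hh
  rcases lt_trichotomy h 0 with hh | rfl | hh
  · have := key2 (x + h) (y + h) (-h) hxh hyh (by simpa using hx) (by simpa using hy) (by linarith)
    simp only [add_neg_cancel_right, abs_neg, add_sub_add_right_eq_sub] at this
    rw [← abs_neg (_ - _ - _)]
    convert this using 2
    ring
  · simp
  · exact key2 x y h hx hy hxh hyh hh

/-- For a phase with `|φ''| ≥ c`, the increments `φ (x + h) - φ x` are well spaced in `x`. -/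
theorem le_abs_sub_sub_sub_of_abs_iteratedDerivWithin_ge {φ : ℝ → ℝ} {c : ℝ}
    (hc : 0 < c) (hφ : ContDiffOn ℝ 2 φ (Set.Icc 0 1))
    (hφ'' : ∀ x ∈ Set.Icc (0 : ℝ) 1, c ≤ |iteratedDerivWithin 2 φ (Set.Icc 0 1) x|)
    {x y h : ℝ} (hx : x ∈ Set.Icc (0 : ℝ) 1) (hy : y ∈ Set.Icc (0 : ℝ) 1)
    (hxh : x + h ∈ Set.Icc (0 : ℝ) 1) (hyh : y + h ∈ Set.Icc (0 : ℝ) 1) :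
    c * |h| * |x - y| ≤ |(φ (x + h) - φ x) - (φ (y + h) - φ y)| := by
  have hcont := hφ.continuousOn_iteratedDerivWithin (m := 2) (by norm_num)
    (uniqueDiffOn_Icc zero_lt_one)
  by_cases hpos : ∀ x ∈ Set.Icc (0 : ℝ) 1, 0 < iteratedDerivWithin 2 φ (Set.Icc 0 1) x
  · refine le_abs_sub_sub_sub_of_iteratedDerivWithin_ge hφ (fun z hz => ?_) hx hy hxh hyh
    simpa [abs_of_pos (hpos z hz)] using hφ'' z hz
  · push Not at hpos
    obtain ⟨w, hw, hw0⟩ := hpos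
    have hneg : ∀ z ∈ Set.Icc (0 : ℝ) 1, iteratedDerivWithin 2 φ (Set.Icc 0 1) z < 0 := by
      intro z hz
      by_contra! hz0
      obtain ⟨v, hv, hv0⟩ := isPreconnected_Icc.intermediate_value hw hz hcont ⟨hw0, hz0⟩
      have := hφ'' v hv
      rw [hv0, abs_zero] at this
      linarith
    have := le_abs_sub_sub_sub_of_iteratedDerivWithin_ge (φ := -φ) (c := c) hφ.neg (fun z hz => ?_)
      hx hy hxh hyh
    · rw [← abs_neg (_ - _ - _)]
      convert this using 2
      simp only [Pi.neg_apply]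
      ring
    · rw [iteratedDerivWithin_neg]
      simpa [abs_of_neg (hneg z hz)] using hφ'' z hz

/-- The nonzero integers of absolute value at most `B`. -/
noncomputable def nonzeroInts (B : ℕ) : Finset ℤ := (Finset.Icc (-(B : ℤ)) B).erase 0

theorem mem_nonzeroInts {B : ℕ} {x : ℤ} : x ∈ nonzeroInts B ↔ x ≠ 0 ∧ |x| ≤ B := by
  simp [nonzeroInts, abs_le]

theorem card_nonzeroInts (B : ℕ) : (nonzeroInts B).card = 2 * B := by
  rw [nonzeroInts, Finset.card_erase_of_mem (by simp), Int.card_Icc]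
  omega

theorem sum_nonzeroInts_inv_abs (B : ℕ) :
    ∑ x ∈ nonzeroInts B, |(x : ℝ)|⁻¹ = 2 * (harmonic B : ℝ) := by
  induction B with
  | zero => simp [nonzeroInts]
  | succ B ih =>
    have h : nonzeroInts (B + 1) = insert (B + 1 : ℤ) (insert (-(B + 1 : ℤ)) (nonzeroInts B)) := by
      ext x
      simp only [Finset.mem_insert, mem_nonzeroInts, abs_le]
      push_cast
      omega
    rw [h, Finset.sum_insert, Finset.sum_insert, ih, harmonic_succ]
    · have h0 : (0 : ℝ) < (B : ℝ) + 1 := by positivity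
      have h1 : |((B + 1 : ℤ) : ℝ)| = B + 1 := by push_cast; exact abs_of_pos h0
      have h2 : |((-(B + 1 : ℤ) : ℤ) : ℝ)| = B + 1 := by
        rw [Int.cast_neg, abs_neg, h1]
      rw [h1, h2]
      push_cast
      ring
    · simp only [mem_nonzeroInts, abs_le]
      omega
    · simp only [Finset.mem_insert, mem_nonzeroInts, abs_le]
      omega

theorem sum_nonzeroInts_inv_abs_le (B : ℕ) :
    ∑ x ∈ nonzeroInts B, |(x : ℝ)|⁻¹ ≤ 2 * (1 + Real.log B) := by
  rw [sum_nonzeroInts_inv_abs]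
  gcongr
  exact harmonic_le_one_add_log B

/-- Pairs of nonzero integers with product of absolute value at most `B`. -/
noncomputable def hyperbolaPairs (B : ℕ) : Finset (ℤ × ℤ) :=
  (nonzeroInts B ×ˢ nonzeroInts B).filter fun p => |p.1 * p.2| ≤ B

theorem mem_hyperbolaPairs {B : ℕ} {p : ℤ × ℤ} :
    p ∈ hyperbolaPairs B ↔ p.1 ≠ 0 ∧ p.2 ≠ 0 ∧ |p.1 * p.2| ≤ B := by
  simp only [hyperbolaPairs, Finset.mem_filter, Finset.mem_product, mem_nonzeroInts]
  refine ⟨fun h => ⟨h.1.1.1, h.1.2.1, h.2⟩, fun ⟨h1, h2, h3⟩ => ⟨⟨⟨h1, ?_⟩, h2, ?_⟩, h3⟩⟩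
  · rw [abs_mul] at h3
    nlinarith [Int.one_le_abs h1, Int.one_le_abs h2]
  · rw [abs_mul] at h3
    nlinarith [Int.one_le_abs h1, Int.one_le_abs h2]

theorem card_hyperbolaPairs_le (B : ℕ) :
    ((hyperbolaPairs B).card : ℝ) ≤ 4 * B * (1 + Real.log B) := by
  have hfib : ∀ x ∈ nonzeroInts B,
      (((hyperbolaPairs B).filter fun p => p.1 = x).card : ℝ) ≤ 2 * B * |(x : ℝ)|⁻¹ := by
    intro x hx
    rw [mem_nonzeroInts] at hx
    have hpos : 0 < x.natAbs := Int.natAbs_pos.2 hx.1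
    have hle : ((hyperbolaPairs B).filter fun p => p.1 = x).card
        ≤ (nonzeroInts (B / x.natAbs)).card := by
      refine Finset.card_le_card_of_injOn Prod.snd ?_ ?_
      · intro p hp
        simp only [Finset.coe_filter, Set.mem_ofPred_eq, mem_hyperbolaPairs] at hp
        obtain ⟨⟨_, h2, h3⟩, rfl⟩ := hp
        simp only [Finset.mem_coe, mem_nonzeroInts]
        refine ⟨h2, ?_⟩
        rw [Int.abs_eq_natAbs] at h3 ⊢
        rw [Int.natAbs_mul] at h3
        norm_cast at h3 ⊢
        rw [Nat.le_div_iff_mul_le hpos]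
        linarith
      · intro p hp q hq h
        simp only [Finset.coe_filter, Set.mem_ofPred_eq] at hp hq
        exact Prod.ext (hp.2.trans hq.2.symm) h
    rw [card_nonzeroInts] at hle
    calc _ ≤ ((2 * (B / x.natAbs) : ℕ) : ℝ) := by exact_mod_cast hle
      _ ≤ 2 * (B / x.natAbs : ℝ) := by
          push_cast
          gcongr
          exact Nat.cast_div_le
      _ = _ := by
          rw [Nat.cast_natAbs, Int.cast_abs]
          ring
  rw [Finset.card_eq_sum_card_fiberwise (f := Prod.fst) (t := nonzeroInts B)]
  · push_cast
    calc _ ≤ ∑ x ∈ nonzeroInts B, 2 * B * |(x : ℝ)|⁻¹ := Finset.sum_le_sum hfib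
      _ = 2 * B * ∑ x ∈ nonzeroInts B, |(x : ℝ)|⁻¹ := by rw [Finset.mul_sum]
      _ ≤ 2 * B * (2 * (1 + Real.log B)) := by
          gcongr
          exact sum_nonzeroInts_inv_abs_le B
      _ = _ := by ring
  · intro p hp
    simp only [hyperbolaPairs, Finset.coe_filter, Set.mem_ofPred_eq, Finset.mem_product] at hp
    exact hp.1.1

theorem sum_hyperbolaPairs_inv_le (B : ℕ) :
    ∑ p ∈ hyperbolaPairs B, |((p.1 * p.2 : ℤ) : ℝ)|⁻¹ ≤ (2 * (1 + Real.log B)) ^ 2 := by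
  calc _ ≤ ∑ p ∈ nonzeroInts B ×ˢ nonzeroInts B, |((p.1 * p.2 : ℤ) : ℝ)|⁻¹ :=
        Finset.sum_le_sum_of_subset_of_nonneg (Finset.filter_subset _ _)
          fun _ _ _ => by positivity
    _ = (∑ x ∈ nonzeroInts B, |(x : ℝ)|⁻¹) ^ 2 := by
        rw [sq, Finset.sum_mul_sum, Finset.sum_product]
        simp [abs_mul, mul_comm]
    _ ≤ _ := by
        gcongr
        exact sum_nonzeroInts_inv_abs_le B

/-- Quadruples of nonzero integers of absolute value at most `B` with `a b = c d`. -/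
noncomputable def equalProducts (B : ℕ) : Finset ((ℤ × ℤ) × (ℤ × ℤ)) :=
  ((nonzeroInts B ×ˢ nonzeroInts B) ×ˢ (nonzeroInts B ×ˢ nonzeroInts B)).filter
    fun q => q.1.1 * q.1.2 = q.2.1 * q.2.2

/-- The quadruple `a b = c d` factors as `a = x y`, `b = z w`, `c = x z`, `d = y w`. -/
theorem equalProducts_subset_image (B : ℕ) :
    equalProducts B ⊆ (hyperbolaPairs B ×ˢ hyperbolaPairs B).image
      fun p => ((p.1.1 * p.1.2, p.2.1 * p.2.2), (p.1.1 * p.2.1, p.1.2 * p.2.2)) := by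
  rintro ⟨⟨a, b⟩, ⟨c, d⟩⟩ h
  simp only [equalProducts, Finset.mem_filter, Finset.mem_product, mem_nonzeroInts] at h
  obtain ⟨⟨⟨⟨ha, haB⟩, hb, hbB⟩, ⟨hc, _⟩, hd, _⟩, heq⟩ := h
  obtain ⟨x, y, ⟨z, rfl⟩, ⟨w, rfl⟩, rfl⟩ := exists_dvd_and_dvd_of_dvd_mul (Dvd.intro b heq)
  have hbzw : b = z * w := by
    apply mul_left_cancel₀ ha
    rw [heq]
    ring
  subst hbzw
  rw [Finset.mem_image]
  refine ⟨((x, y), (z, w)), ?_, rfl⟩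
  simp only [Finset.mem_product, mem_hyperbolaPairs]
  exact ⟨⟨left_ne_zero_of_mul ha, right_ne_zero_of_mul ha, haB⟩,
    left_ne_zero_of_mul hb, right_ne_zero_of_mul hb, hbB⟩

theorem sum_equalProducts_le (B : ℕ) (E : ℝ) (hE : 0 ≤ E) :
    ∑ q ∈ equalProducts B, (1 + E * |((q.1.1 * q.1.2 : ℤ) : ℝ)|⁻¹)
      ≤ (4 * B * (1 + Real.log B)) ^ 2
        + E * ((2 * (1 + Real.log B)) ^ 2 * (4 * B * (1 + Real.log B))) := by
  have hlog : 0 ≤ Real.log B := Real.log_natCast_nonneg B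
  calc _ ≤ _ := Finset.sum_le_sum_of_subset_of_nonneg (equalProducts_subset_image B)
        fun _ _ _ => by positivity
    _ ≤ ∑ p ∈ hyperbolaPairs B ×ˢ hyperbolaPairs B,
        (1 + E * |((p.1.1 * p.1.2 * (p.2.1 * p.2.2) : ℤ) : ℝ)|⁻¹) :=
      Finset.sum_image_le_of_nonneg (fun _ _ => by positivity)
    _ ≤ ∑ p ∈ hyperbolaPairs B ×ˢ hyperbolaPairs B,
        (1 + E * |((p.1.1 * p.1.2 : ℤ) : ℝ)|⁻¹) := by
      refine Finset.sum_le_sum fun p hp => ?_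
      rw [Finset.mem_product, mem_hyperbolaPairs, mem_hyperbolaPairs] at hp
      have h1 : (0 : ℝ) < |((p.1.1 * p.1.2 : ℤ) : ℝ)| :=
        abs_pos.2 (by exact_mod_cast mul_ne_zero hp.1.1 hp.1.2.1)
      have h2 : (1 : ℝ) ≤ |((p.2.1 * p.2.2 : ℤ) : ℝ)| := by
        exact_mod_cast Int.one_le_abs (mul_ne_zero hp.2.1 hp.2.2.1)
      refine add_le_add_right (mul_le_mul_of_nonneg_left (inv_anti₀ h1 ?_) hE) 1
      rw [Int.cast_mul (p.1.1 * p.1.2), abs_mul]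
      nlinarith
    _ = ((hyperbolaPairs B).card : ℝ) ^ 2
        + E * ((∑ p ∈ hyperbolaPairs B, |((p.1 * p.2 : ℤ) : ℝ)|⁻¹) * (hyperbolaPairs B).card) := by
      rw [Finset.sum_add_distrib, ← Finset.mul_sum, Finset.sum_product]
      simp only [Finset.sum_const, nsmul_eq_mul, mul_one]
      rw [Finset.sum_product]
      simp only [Finset.sum_const, nsmul_eq_mul, ← Finset.mul_sum]
      push_cast
      ring
    _ ≤ _ := by
      gcongr
      · exact card_hyperbolaPairs_le B
      · exact sum_hyperbolaPairs_inv_le B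
      · exact card_hyperbolaPairs_le B

theorem Finset.card_le_one_add_of_abs_sub_le {S : Finset ℕ} {D : ℝ} (hD : 0 ≤ D)
    (h : ∀ a ∈ S, ∀ b ∈ S, |(a : ℝ) - b| ≤ D) : (S.card : ℝ) ≤ 1 + D := by
  rcases S.eq_empty_or_nonempty with rfl | hS
  · simp
    linarith
  · have hsub : S ⊆ Finset.Icc (S.min' hS) (S.max' hS) := fun a ha =>
      Finset.mem_Icc.2 ⟨S.min'_le a ha, S.le_max' a ha⟩
    have hcard := Finset.card_le_card hsub
    rw [Nat.card_Icc] at hcard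
    have hle := S.min'_le_max' hS
    have h1 := (le_abs_self _).trans (h _ (S.max'_mem hS) _ (S.min'_mem hS))
    have h2 : S.card + S.min' hS ≤ S.max' hS + 1 := by omega
    have h3 : (S.card : ℝ) + (S.min' hS : ℕ) ≤ (S.max' hS : ℕ) + 1 := by exact_mod_cast h2
    linarith

/-- Triples `(ℓ, j, k)` indexing the off-diagonal terms of the pair correlation sum. -/
noncomputable def offDiagIndex (B N : ℕ) : Finset (ℤ × ℕ × ℕ) :=
  (nonzeroInts B ×ˢ (Finset.Icc 1 N ×ˢ Finset.Icc 1 N)).filter fun i => i.2.1 ≠ i.2.2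

/-- The `β`-frequency `ℓ (j - k)` of an off-diagonal term. -/
def linearFreq (i : ℤ × ℕ × ℕ) : ℤ := i.1 * (i.2.1 - i.2.2)

/-- The `α`-frequency `N ℓ (φ (j / N) - φ (k / N))` of an off-diagonal term. -/
noncomputable def phaseFreq (φ : ℝ → ℝ) (N : ℕ) (i : ℤ × ℕ × ℕ) : ℝ :=
  N * (i.1 * (φ (i.2.1 / N) - φ (i.2.2 / N)))

/-- Pairs of off-diagonal terms with equal `β`-frequencies and nearby `α`-frequencies. -/
noncomputable def closePairs (φ : ℝ → ℝ) (B N : ℕ) :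
    Finset ((ℤ × ℕ × ℕ) × (ℤ × ℕ × ℕ)) :=
  (offDiagIndex B N ×ˢ offDiagIndex B N).filter fun p =>
    linearFreq p.1 = linearFreq p.2 ∧ |phaseFreq φ N p.1 - phaseFreq φ N p.2| ≤ 1

theorem mem_closePairs {φ : ℝ → ℝ} {B N : ℕ} {p : (ℤ × ℕ × ℕ) × (ℤ × ℕ × ℕ)} :
    p ∈ closePairs φ B N ↔
      (((p.1.1 ∈ nonzeroInts B ∧ p.1.2.1 ∈ Finset.Icc 1 N ∧ p.1.2.2 ∈ Finset.Icc 1 N) ∧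
        p.1.2.1 ≠ p.1.2.2) ∧
      ((p.2.1 ∈ nonzeroInts B ∧ p.2.2.1 ∈ Finset.Icc 1 N ∧ p.2.2.2 ∈ Finset.Icc 1 N) ∧
        p.2.2.1 ≠ p.2.2.2)) ∧
      linearFreq p.1 = linearFreq p.2 ∧ |phaseFreq φ N p.1 - phaseFreq φ N p.2| ≤ 1 := by
  simp only [closePairs, offDiagIndex, Finset.mem_filter, Finset.mem_product]

theorem card_closePairs_le {φ : ℝ → ℝ} {c : ℝ} (hc : 0 < c)
    (hsp : ∀ x y h : ℝ, x ∈ Set.Icc (0 : ℝ) 1 → y ∈ Set.Icc (0 : ℝ) 1 →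
      x + h ∈ Set.Icc (0 : ℝ) 1 → y + h ∈ Set.Icc (0 : ℝ) 1 →
      c * |h| * |x - y| ≤ |(φ (x + h) - φ x) - (φ (y + h) - φ y)|)
    {B N : ℕ} (hN : 0 < N) (hNB : N ≤ B) :
    ((closePairs φ B N).card : ℝ) ≤
      N * ∑ q ∈ equalProducts B, (1 + 2 * N / c * |((q.1.1 * q.1.2 : ℤ) : ℝ)|⁻¹) := by
  have hN' : (0 : ℝ) < N := by exact_mod_cast hN
  let key : (ℤ × ℕ × ℕ) × (ℤ × ℕ × ℕ) → ((ℤ × ℤ) × (ℤ × ℤ)) × ℕ := fun p =>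
    (((p.1.1, (p.1.2.1 : ℤ) - p.1.2.2), (p.2.1, (p.2.2.1 : ℤ) - p.2.2.2)), p.1.2.2)
  have hmem : ∀ j ∈ Finset.Icc 1 N, ((j : ℝ) / N) ∈ Set.Icc (0 : ℝ) 1 := by
    intro j hj
    rw [Finset.mem_Icc] at hj
    refine ⟨by positivity, ?_⟩
    rw [div_le_one hN']
    exact_mod_cast hj.2
  have hmaps : Set.MapsTo key (closePairs φ B N) (equalProducts B ×ˢ Finset.Icc 1 N : Finset _) := by
    intro p hp
    rw [Finset.mem_coe, mem_closePairs] at hp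
    obtain ⟨⟨⟨⟨h1, h2, h3⟩, h4⟩, ⟨h5, h6, h7⟩, h8⟩, h9, -⟩ := hp
    have hd : ∀ j ∈ Finset.Icc 1 N, ∀ k ∈ Finset.Icc 1 N, j ≠ k →
        (j : ℤ) - k ∈ nonzeroInts B := by
      intro j hj k hk hjk
      rw [Finset.mem_Icc] at hj hk
      rw [mem_nonzeroInts, abs_le]
      omega
    simp only [key, Finset.mem_coe, Finset.mem_product, equalProducts, Finset.mem_filter]
    exact ⟨⟨⟨⟨h1, hd _ h2 _ h3 h4⟩, h5, hd _ h6 _ h7 h8⟩, h9⟩, h3⟩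
  have hfib : ∀ z ∈ equalProducts B ×ˢ Finset.Icc 1 N,
      (((closePairs φ B N).filter fun p => key p = z).card : ℝ) ≤
        1 + 2 * N / c * |((z.1.1.1 * z.1.1.2 : ℤ) : ℝ)|⁻¹ := by
    intro z _
    have hinj : Set.InjOn (fun p : (ℤ × ℕ × ℕ) × (ℤ × ℕ × ℕ) => p.2.2.2)
        ((closePairs φ B N).filter fun p => key p = z) := by
      rintro ⟨⟨l, j, k⟩, l', j', k'⟩ hp ⟨⟨m, i, n⟩, m', i', n'⟩ hq h
      simp only [Finset.coe_filter, Set.mem_ofPred_eq] at hp hq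
      have hkey := hp.2.trans hq.2.symm
      simp only [key, Prod.mk.injEq] at hkey h ⊢
      omega
    rw [← Finset.card_image_of_injOn hinj]
    refine Finset.card_le_one_add_of_abs_sub_le (by positivity) ?_
    simp only [Finset.mem_image, Finset.mem_filter]
    rintro _ ⟨p, ⟨hp, hpz⟩, rfl⟩ _ ⟨q, ⟨hq, hqz⟩, rfl⟩
    rw [mem_closePairs] at hp hq
    obtain ⟨⟨⟨⟨h1, -, -⟩, h4⟩, ⟨h5, h6, h7⟩, h8⟩, h9, h10⟩ := hp
    obtain ⟨⟨-, ⟨-, g6, g7⟩, -⟩, -, g10⟩ := hq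
    have hkey := hpz.trans hqz.symm
    obtain ⟨⟨l, j, k⟩, l', j', k'⟩ := p
    obtain ⟨⟨m, i, n⟩, m', i', n'⟩ := q
    simp only [key, Prod.mk.injEq] at *
    obtain ⟨⟨⟨rfl, e1⟩, rfl, e2⟩, rfl⟩ := hkey
    obtain rfl : j = i := by omega
    subst hpz
    simp only at *
    have hL : ((l : ℝ) * (j - k)) = l' * (j' - k') := by
      have := congrArg (Int.cast : ℤ → ℝ) h9
      simpa [linearFreq] using this
    have hLne : ((l : ℝ) * (j - k)) ≠ 0 := by
      rw [mem_nonzeroInts] at h1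
      refine mul_ne_zero (by exact_mod_cast h1.1) (sub_ne_zero.2 (by exact_mod_cast h4))
    have hh : (j' : ℝ) - k' = i' - n' := by exact_mod_cast e2
    have hs := hsp (k' / N) (n' / N) ((j' - k') / N) (hmem _ h7) (hmem _ g7)
      (by rw [← add_div, add_sub_cancel]; exact hmem _ h6)
      (by rw [hh, ← add_div, add_sub_cancel]; exact hmem _ g6)
    rw [← add_div, add_sub_cancel, hh, ← add_div, add_sub_cancel, ← hh] at hs
    have hclose : |phaseFreq φ N (l', j', k') - phaseFreq φ N (l', i', n')| ≤ 2 := by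
      have := abs_sub (phaseFreq φ N (l, j, k) - phaseFreq φ N (l', i', n'))
        (phaseFreq φ N (l, j, k) - phaseFreq φ N (l', j', k'))
      rw [sub_sub_sub_cancel_left] at this
      linarith
    have hfac : |phaseFreq φ N (l', j', k') - phaseFreq φ N (l', i', n')| =
        N * (|(l' : ℝ)| * |φ (j' / N) - φ (k' / N) - (φ (i' / N) - φ (n' / N))|) := by
      rw [← abs_mul, ← abs_of_pos hN', ← abs_mul, abs_of_pos hN']
      congr 1
      simp only [phaseFreq]
      ring
    rw [hfac] at hclose
    have h3 : N * (|(l' : ℝ)| * (c * |((j' : ℝ) - k') / N| * |(k' : ℝ) / N - n' / N|)) ≤ 2 :=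
      le_trans (by gcongr) hclose
    rw [← sub_div, abs_div, abs_div, abs_of_pos hN'] at h3
    have h4' : N * (|(l' : ℝ)| * (c * (|(j' : ℝ) - k'| / N) * (|(k' : ℝ) - n'| / N)))
        = c * |(l : ℝ) * (j - k)| * |(k' : ℝ) - n'| / N := by
      rw [hL, abs_mul]
      field_simp
    rw [h4', div_le_iff₀ hN'] at h3
    push_cast
    have hpos := abs_pos.2 hLne
    rw [← div_eq_mul_inv, div_div, le_div_iff₀ (by positivity)]
    linarith
  rw [Finset.card_eq_sum_card_fiberwise hmaps]
  push_cast
  calc _ ≤ _ := Finset.sum_le_sum hfib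
    _ = _ := by
      rw [Finset.sum_product]
      simp [Finset.mul_sum, mul_add]

/-- Mean square over a box of a two-variable exponential sum whose second frequencies are
integral: it is controlled by the number of pairs of terms with equal second and nearby first
frequencies. -/
theorem exists_integral_integral_norm_sq_expSum_le (t T : ℝ) (ht : t ≠ 0) (hT : 0 < T) :
    ∃ K : ℝ, 0 ≤ K ∧ ∀ (ι : Type) (s : Finset ι) (a : ι → ℂ) (x : ι → ℝ) (y : ι → ℤ) (M : ℝ),
      (∀ i ∈ s, ‖a i‖ ≤ M) →
      ∫ α in (-T)..T, ∫ β in (-T)..T,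
          ‖∑ i ∈ s, a i * Complex.exp (Complex.I * ((t * (α * x i + β * y i) : ℝ) : ℂ))‖ ^ 2
        ≤ K * (M ^ 2 *
          ((s ×ˢ s).filter fun p => y p.1 = y p.2 ∧ |x p.1 - x p.2| ≤ 1).card) := by
  have ht0 : 0 < |t| := abs_pos.2 ht
  obtain ⟨K₁, hK₁, h₁⟩ := exists_integral_norm_sq_expSum_le T (|t| / 2) hT (by positivity)
  obtain ⟨K₂, hK₂, h₂⟩ := exists_integral_norm_sq_expSum_le T |t| hT ht0
  refine ⟨K₁ * K₂, by positivity, fun ι s a x y M hM => ?_⟩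
  classical
  let F : ℤ → ℝ → ℂ := fun n α =>
    ∑ i ∈ s with y i = n, a i * Complex.exp (Complex.I * ((t * x i * α : ℝ) : ℂ))
  have hinner : ∀ α : ℝ, ∫ β in (-T)..T,
      ‖∑ i ∈ s, a i * Complex.exp (Complex.I * ((t * (α * x i + β * y i) : ℝ) : ℂ))‖ ^ 2
        ≤ K₁ * ∑ n ∈ s.image y, ‖F n α‖ ^ 2 := by
    intro α
    have heq : ∀ β : ℝ,
        ∑ i ∈ s, a i * Complex.exp (Complex.I * ((t * (α * x i + β * y i) : ℝ) : ℂ)) =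
          ∑ n ∈ s.image y, F n α * Complex.exp (Complex.I * ((t * n * β : ℝ) : ℂ)) := by
      intro β
      rw [← Finset.sum_fiberwise_of_maps_to (g := y) (t := s.image y)
        fun i hi => Finset.mem_image_of_mem y hi]
      refine Finset.sum_congr rfl fun n _ => ?_
      rw [Finset.sum_mul]
      refine Finset.sum_congr rfl fun i hi => ?_
      rw [mul_assoc, ← Complex.exp_add, (Finset.mem_filter.1 hi).2]
      congr 2
      push_cast
      ring
    simp_rw [heq]
    refine (h₁ ℤ _ (fun n => F n α) (fun n => t * n)).trans (le_of_eq ?_)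
    congr 1
    refine Finset.sum_congr rfl fun n hn => ?_
    rw [Finset.sum_eq_single n]
    · rw [if_pos (by rw [sub_self, abs_zero]; positivity), sq]
    · intro m _ hmn
      rw [if_neg]
      rw [← mul_sub, abs_mul, not_le]
      have : (1 : ℝ) ≤ |(n : ℝ) - m| := by
        exact_mod_cast Int.one_le_abs (sub_ne_zero.2 hmn.symm)
      nlinarith
    · exact fun h => absurd hn h
  have houter : ∀ n, ∫ α in (-T)..T, ‖F n α‖ ^ 2 ≤
      K₂ * ∑ i ∈ s with y i = n, ∑ j ∈ s with y j = n, if |x i - x j| ≤ 1 then M ^ 2 else 0 := by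
    intro n
    refine (h₂ ι _ a fun i => t * x i).trans ?_
    refine mul_le_mul_of_nonneg_left ?_ hK₂
    refine Finset.sum_le_sum fun i hi => Finset.sum_le_sum fun j hj => ?_
    have hiff : |t * x i - t * x j| ≤ |t| ↔ |x i - x j| ≤ 1 := by
      rw [← mul_sub, abs_mul]
      exact mul_le_iff_le_one_right ht0
    simp only [hiff]
    split_ifs
    · rw [sq]
      exact mul_le_mul (hM i (Finset.mem_filter.1 hi).1) (hM j (Finset.mem_filter.1 hj).1)
        (norm_nonneg _) ((norm_nonneg _).trans (hM i (Finset.mem_filter.1 hi).1))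
    · exact le_rfl
  have hFc : ∀ n, Continuous fun α => ‖F n α‖ ^ 2 := fun n => by
    simp only [F]
    fun_prop
  calc _ ≤ ∫ α in (-T)..T, K₁ * ∑ n ∈ s.image y, ‖F n α‖ ^ 2 := by
        refine intervalIntegral.integral_mono (by linarith) ?_ ?_ hinner
        · refine Continuous.intervalIntegrable ?_ _ _
          refine intervalIntegral.continuous_parametric_intervalIntegral_of_continuous' ?_ _ _
          simp only [Function.uncurry_def]
          fun_prop
        · exact Continuous.intervalIntegrable (by fun_prop) _ _
    _ = K₁ * ∑ n ∈ s.image y, ∫ α in (-T)..T, ‖F n α‖ ^ 2 := by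
        rw [intervalIntegral.integral_const_mul, intervalIntegral.integral_finsetSum]
        exact fun n _ => (hFc n).intervalIntegrable _ _
    _ ≤ K₁ * ∑ n ∈ s.image y, K₂ * ∑ i ∈ s with y i = n, ∑ j ∈ s with y j = n,
          if |x i - x j| ≤ 1 then M ^ 2 else 0 := by
        gcongr with n hn
        exact houter n
    _ = K₁ * K₂ * ∑ n ∈ s.image y, ∑ i ∈ s with y i = n, ∑ j ∈ s with y j = y i,
          if |x i - x j| ≤ 1 then M ^ 2 else 0 := by
        rw [← Finset.mul_sum, mul_assoc]
        congr 2
        refine Finset.sum_congr rfl fun n _ => Finset.sum_congr rfl fun i hi => ?_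
        rw [(Finset.mem_filter.1 hi).2]
    _ = _ := by
        rw [Finset.sum_fiberwise_of_maps_to fun i hi => Finset.mem_image_of_mem y hi,
          mul_comm (M ^ 2), ← nsmul_eq_mul, ← Finset.sum_const, Finset.sum_filter,
          Finset.sum_product]
        congr 1
        refine Finset.sum_congr rfl fun i _ => ?_
        rw [Finset.sum_filter]
        refine Finset.sum_congr rfl fun j _ => ?_
        simp only [ite_and, eq_comm]

theorem norm_FT_le (f : ℝ → ℝ) (ξ : ℝ) : ‖FT f ξ‖ ≤ ∫ x, ‖f x‖ := by
  refine (norm_integral_le_integral_norm _).trans (le_of_eq ?_)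
  refine integral_congr_ae (ae_of_all _ fun x => ?_)
  simp only [norm_mul, Complex.norm_real]
  rw [show -(Complex.I * x * ξ) = ((-(x * ξ) : ℝ) : ℂ) * Complex.I by push_cast; ring,
    Complex.norm_exp_ofReal_mul_I, mul_one]

open scoped FourierTransform in
theorem fourier_dilation_eq_FT (f : ℝ → ℝ) {r : ℝ} (hr : 0 < r) (w : ℝ) :
    𝓕 (fun x => (f (r * x) : ℂ)) w = (1 / r : ℂ) * FT f (2 * π * w / r) := by
  rw [Real.fourier_real_eq_integral_exp_smul, FT]
  have h := Measure.integral_comp_mul_left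
    (fun x : ℝ => (f x : ℂ) * Complex.exp (-(Complex.I * x * (2 * π * w / r : ℝ)))) r
  rw [abs_of_pos (inv_pos.2 hr), Complex.real_smul] at h
  rw [one_div, ← Complex.ofReal_inv, ← h]
  refine integral_congr_ae (ae_of_all _ fun v => ?_)
  have hr0 : (r : ℂ) ≠ 0 := by exact_mod_cast hr.ne'
  simp only [smul_eq_mul]
  rw [mul_comm]
  congr 2
  push_cast
  field_simp

open scoped FourierTransform in
/-- The values of `FT f` at multiples of `2π / N` have average `f 0` up to `O(1 / N)`. -/
theorem exists_norm_tsum_FT_sub_le (f : SchwartzMap ℝ ℝ) {A : ℕ}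
    (hA : ∀ ξ : ℝ, 2 * π * A < |ξ| → FT f ξ = 0) :
    ∃ K : ℝ, 0 ≤ K ∧ ∀ N : ℕ, 0 < N →
      ‖(1 / N : ℂ) * ∑' ℓ : ℤ, FT f (2 * π * ℓ / N) - (f 0 : ℂ)‖ ≤ K / N := by
  obtain ⟨C, hC⟩ := f.decay 2 0
  simp only [norm_iteratedFDeriv_zero] at hC
  have hC0 : 0 ≤ C := (by positivity : (0 : ℝ) ≤ ‖(0 : ℝ)‖ ^ 2 * ‖f 0‖).trans (hC.2 0)
  have hC := hC.2
  have hsum : Summable fun n : ℤ => ((n : ℝ) ^ 2)⁻¹ := by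
    simpa using Real.summable_one_div_int_pow.2 one_lt_two
  refine ⟨C * ∑' n : ℤ, ((n : ℝ) ^ 2)⁻¹, by positivity, fun N hN => ?_⟩
  have hN' : (0 : ℝ) < N := by exact_mod_cast hN
  have hN1 : (1 : ℝ) ≤ N := by exact_mod_cast hN
  let g : ℝ → ℂ := fun x => (f (N * x) : ℂ)
  have hg : ∀ x : ℝ, x ≠ 0 → ‖g x‖ ≤ C / N * (x ^ 2)⁻¹ := by
    intro x hx
    have h1 := hC (N * x)
    have hx2 : 0 < x ^ 2 := by positivity
    rw [Real.norm_eq_abs (N * x), sq_abs, mul_pow] at h1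
    rw [← div_eq_mul_inv, le_div_iff₀ hx2, le_div_iff₀ hN', Complex.norm_real]
    refine le_trans ?_ h1
    have h2 : (N : ℝ) ≤ N ^ 2 := by nlinarith
    calc ‖f (N * x)‖ * x ^ 2 * N ≤ ‖f (N * x)‖ * x ^ 2 * N ^ 2 := by gcongr
      _ = _ := by ring
  have hgO : g =O[cocompact ℝ] fun x : ℝ => |x| ^ (-2 : ℝ) := by
    refine Asymptotics.IsBigO.of_bound (C / N) ?_
    filter_upwards [(isCompact_singleton (x := (0 : ℝ))).compl_mem_cocompact] with x hx
    refine (hg x hx).trans (le_of_eq ?_)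
    rw [Real.rpow_neg (abs_nonneg x), Real.rpow_two, sq_abs, Real.norm_of_nonneg (by positivity)]
  have hF : ∀ n : ℤ, 𝓕 g n = (1 / N : ℂ) * FT f (2 * π * n / N) := fun n => by
    simpa using fourier_dilation_eq_FT f hN' n
  have hFs : Summable fun n : ℤ => 𝓕 g n := by
    refine summable_of_ne_finset_zero (s := Finset.Icc (-(A * N : ℤ)) (A * N)) fun n hn => ?_
    rw [hF, hA, mul_zero]
    rw [Finset.mem_Icc, ← abs_le, not_le] at hn
    have hn' : (A * N : ℝ) < |(n : ℝ)| := by exact_mod_cast hn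
    rw [abs_div, abs_mul, abs_of_pos Real.two_pi_pos, abs_of_pos hN', lt_div_iff₀ hN', mul_assoc]
    gcongr
  have hP := Real.tsum_eq_tsum_fourier_of_rpow_decay_of_summable (f := g) (by fun_prop)
    one_lt_two hgO hFs 0
  simp only [zero_add, QuotientAddGroup.mk_zero, fourier_eval_zero, mul_one] at hP
  simp_rw [hF] at hP
  rw [tsum_mul_left] at hP
  rw [← hP]
  have hbd : ∀ n : ℤ, ‖(if n = 0 then 0 else g n : ℂ)‖ ≤ C / N * ((n : ℝ) ^ 2)⁻¹ := by
    intro n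
    split_ifs with h
    · simp [h]
    · exact hg n (by exact_mod_cast h)
  have hite : Summable fun n : ℤ => (if n = 0 then 0 else g n : ℂ) :=
    Summable.of_norm_bounded (hsum.mul_left _) hbd
  have hgs : Summable fun n : ℤ => g n := by
    refine (hite.add (summable_of_ne_finset_zero (s := {0})
      (f := fun n : ℤ => if n = 0 then g n else 0) ?_)).congr ?_
    · intro n hn
      simpa using fun h => absurd h (by simpa using hn)
    · intro n
      split_ifs <;> simp
  rw [hgs.tsum_eq_add_tsum_ite 0]
  simp only [Int.cast_zero, g, mul_zero, add_sub_cancel_left]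
  refine (tsum_of_norm_bounded (hsum.mul_left (C / N)).hasSum hbd).trans (le_of_eq ?_)
  rw [tsum_mul_left]
  ring

theorem norm_sq_sum_exp (s : Finset ℕ) (θ : ℕ → ℝ) :
    ((‖∑ j ∈ s, Complex.exp (Complex.I * (θ j : ℂ))‖ ^ 2 : ℝ) : ℂ) =
      s.card + ∑ p ∈ (s ×ˢ s).filter fun p => p.1 ≠ p.2,
        Complex.exp (Complex.I * ((θ p.1 - θ p.2 : ℝ) : ℂ)) := by
  have h1 : ((‖∑ j ∈ s, Complex.exp (Complex.I * (θ j : ℂ))‖ ^ 2 : ℝ) : ℂ) =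
      ∑ p ∈ s ×ˢ s, Complex.exp (Complex.I * ((θ p.1 - θ p.2 : ℝ) : ℂ)) := by
    push_cast
    rw [← Complex.mul_conj', map_sum, Finset.sum_mul_sum, Finset.sum_product]
    refine Finset.sum_congr rfl fun j _ => Finset.sum_congr rfl fun k _ => ?_
    rw [← Complex.exp_conj, ← Complex.exp_add]
    congr 1
    simp only [map_mul, Complex.conj_I, Complex.conj_ofReal]
    ring
  rw [h1, ← Finset.sum_filter_add_sum_filter_not (s ×ˢ s) fun p => p.1 = p.2]
  congr 1
  rw [Finset.sum_filter, Finset.sum_product]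
  simp

/-- The pair correlation sum minus its Poisson limit is the off-diagonal exponential sum plus an
error independent of `(α, β)`. -/
theorem pairCorrelation_sub_eq {F : ℝ → ℂ} {B N : ℕ} (hN : 0 < N)
    (hF : ∀ ℓ : ℤ, (B : ℤ) < |ℓ| → F (2 * π * ℓ / N) = 0) (φ : ℝ → ℝ) (t α β : ℝ) (z : ℂ) :
    ((1 / (N : ℝ) ^ 2 : ℝ) : ℂ) * (∑' ℓ : ℤ, F (2 * π * ℓ / N) *
        ((‖∑ j ∈ Finset.Icc 1 N, Complex.exp (Complex.I *
          ((t * ℓ * N * (α * φ ((j : ℝ) / N) + β * ((j : ℝ) / N)) : ℝ) : ℂ))‖ ^ 2 : ℝ) : ℂ))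
      - (z + F 0) =
    ((1 / (N : ℝ) ^ 2 : ℝ) : ℂ) * (∑ i ∈ offDiagIndex B N, F (2 * π * i.1 / N) *
        Complex.exp (Complex.I *
          ((t * (α * phaseFreq φ N i + β * linearFreq i) : ℝ) : ℂ)))
      + (((1 / N : ℂ) * ∑' ℓ : ℤ, F (2 * π * ℓ / N) - z) - F 0 / N) := by
  have hN0 : (N : ℂ) ≠ 0 := by exact_mod_cast hN.ne'
  have hNr : (N : ℝ) ≠ 0 := by exact_mod_cast hN.ne'
  have hout : ∀ ℓ : ℤ, ℓ ∉ Finset.Icc (-(B : ℤ)) B → F (2 * π * ℓ / N) = 0 := fun ℓ hℓ => by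
    rw [Finset.mem_Icc, ← abs_le, not_le] at hℓ
    exact hF ℓ hℓ
  have h0 : (0 : ℤ) ∈ Finset.Icc (-(B : ℤ)) B := by simp
  rw [tsum_eq_sum (s := Finset.Icc (-(B : ℤ)) B) (fun ℓ hℓ => by rw [hout ℓ hℓ, zero_mul]),
    tsum_eq_sum (s := Finset.Icc (-(B : ℤ)) B) hout, ← Finset.add_sum_erase _ _ h0,
    ← Finset.add_sum_erase _ _ h0]
  change _ * (_ + ∑ ℓ ∈ nonzeroInts B, _) - _ = _ + (_ * (_ + ∑ ℓ ∈ nonzeroInts B, _) - _ - _)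
  have hdiag : ∀ ℓ : ℤ, F (2 * π * ℓ / N) *
        ((‖∑ j ∈ Finset.Icc 1 N, Complex.exp (Complex.I *
          ((t * ℓ * N * (α * φ ((j : ℝ) / N) + β * ((j : ℝ) / N)) : ℝ) : ℂ))‖ ^ 2 : ℝ) : ℂ) =
      N * F (2 * π * ℓ / N) + ∑ p ∈ (Finset.Icc 1 N ×ˢ Finset.Icc 1 N).filter
          fun p => p.1 ≠ p.2, F (2 * π * ℓ / N) * Complex.exp (Complex.I *
          ((t * (α * phaseFreq φ N (ℓ, p) + β * linearFreq (ℓ, p)) : ℝ) : ℂ)) := by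
    intro ℓ
    rw [norm_sq_sum_exp, Nat.card_Icc, Nat.add_sub_cancel, mul_add, mul_comm (F _), Finset.mul_sum]
    congr 1
    refine Finset.sum_congr rfl fun p _ => ?_
    congr 4
    simp only [phaseFreq, linearFreq]
    push_cast
    field_simp
    ring
  have hoff : ∑ i ∈ offDiagIndex B N, F (2 * π * i.1 / N) * Complex.exp (Complex.I *
          ((t * (α * phaseFreq φ N i + β * linearFreq i) : ℝ) : ℂ)) =
      ∑ ℓ ∈ nonzeroInts B, ∑ p ∈ (Finset.Icc 1 N ×ˢ Finset.Icc 1 N).filter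
          fun p => p.1 ≠ p.2, F (2 * π * ℓ / N) * Complex.exp (Complex.I *
          ((t * (α * phaseFreq φ N (ℓ, p) + β * linearFreq (ℓ, p)) : ℝ) : ℂ)) := by
    rw [offDiagIndex, Finset.sum_filter, Finset.sum_product]
    simp_rw [← Finset.sum_filter]
  rw [Finset.sum_congr rfl fun ℓ _ => hdiag ℓ, Finset.sum_add_distrib, ← hoff, ← Finset.mul_sum]
  simp only [Int.cast_zero, mul_zero, zero_div, zero_mul, Complex.ofReal_zero, Complex.exp_zero,
    Finset.sum_const, Nat.card_Icc, Nat.add_sub_cancel, nsmul_eq_mul, mul_one, Complex.norm_natCast]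
  push_cast
  field_simp
  ring

theorem card_closePairs_le_log_cube {φ : ℝ → ℝ} {c : ℝ} (hc : 0 < c)
    (hsp : ∀ x y h : ℝ, x ∈ Set.Icc (0 : ℝ) 1 → y ∈ Set.Icc (0 : ℝ) 1 →
      x + h ∈ Set.Icc (0 : ℝ) 1 → y + h ∈ Set.Icc (0 : ℝ) 1 →
      c * |h| * |x - y| ≤ |(φ (x + h) - φ x) - (φ (y + h) - φ y)|)
    {A : ℕ} (hA : 1 ≤ A) :
    ∃ K : ℝ, 0 ≤ K ∧ ∀ N : ℕ, 2 ≤ N →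
      ((closePairs φ (A * N) N).card : ℝ) ≤ K * N ^ 3 * Real.log N ^ 3 := by
  have hlA : 0 ≤ Real.log A := Real.log_natCast_nonneg A
  set L : ℝ := 2 * (1 + Real.log A) + 1 with hL
  have hL0 : 0 ≤ L := by positivity
  refine ⟨32 * A ^ 2 * L ^ 2 + 32 * A / c * L ^ 3, by positivity, fun N hN => ?_⟩
  have hN0 : (0 : ℝ) < N := by exact_mod_cast (by omega : 0 < N)
  have hlog : 1 / 2 ≤ Real.log N := by
    have h1 : Real.log 2 ≤ Real.log N := Real.log_le_log two_pos (by exact_mod_cast hN)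
    linarith [Real.log_two_gt_d9]
  have hH : 1 + Real.log (A * N : ℕ) ≤ L * Real.log N := by
    push_cast
    rw [Real.log_mul (by positivity) hN0.ne']
    nlinarith
  have hH0 : 0 ≤ 1 + Real.log (A * N : ℕ) := add_nonneg zero_le_one (Real.log_natCast_nonneg _)
  have h1 := card_closePairs_le (B := A * N) hc hsp (by omega : 0 < N) (Nat.le_mul_of_pos_left N hA)
  have h2 := sum_equalProducts_le (A * N) (2 * N / c) (by positivity)
  calc ((closePairs φ (A * N) N).card : ℝ)
      ≤ N * ((4 * (A * N : ℕ) * (L * Real.log N)) ^ 2 + 2 * N / c *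
          ((2 * (L * Real.log N)) ^ 2 * (4 * (A * N : ℕ) * (L * Real.log N)))) := by
        refine h1.trans (mul_le_mul_of_nonneg_left (h2.trans ?_) hN0.le)
        gcongr
    _ = N ^ 3 * (16 * A ^ 2 * L ^ 2 * Real.log N ^ 2 + 32 * A / c * L ^ 3 * Real.log N ^ 3) := by
        push_cast
        ring
    _ ≤ N ^ 3 * (16 * A ^ 2 * L ^ 2 * (2 * Real.log N ^ 3) +
          32 * A / c * L ^ 3 * Real.log N ^ 3) := by
        gcongr
        nlinarith [sq_nonneg (Real.log N)]
    _ = _ := by ring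

/-- Zelditch, Theorem 5.1.1 (Theorem B(b) for general non-degenerate phases): for the
two-parameter family `Ĥ_{α,β} = α φ(Î) + β Î` with `0 < c ≤ |φ''| ≤ C'`, the variance
over `(α,β)` of the pair correlation functional around the Poisson limit `f(0) + f̂(0)`
is `O((log N)³/N)`. -/
theorem variance_pair_correlation_nondegenerate
    (φ : ℝ → ℝ) (c C' : ℝ) (hc : 0 < c)
    (hφ : ContDiffOn ℝ 2 φ (Set.Icc 0 1))
    (hφ'' : ∀ x ∈ Set.Icc (0:ℝ) 1,
      c ≤ |iteratedDerivWithin 2 φ (Set.Icc 0 1) x| ∧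
      |iteratedDerivWithin 2 φ (Set.Icc 0 1) x| ≤ C')
    (t : ℝ) (ht : t ≠ 0) (T : ℝ) (hT : 0 < T)
    (f : SchwartzMap ℝ ℝ) (hf : HasCompactSupport (FT f)) :
    ∃ C : ℝ, ∀ N : ℕ, 2 ≤ N →
      (1 / (2 * T) ^ 2) * (∫ α in (-T)..T, ∫ β in (-T)..T,
        ‖((1 / (N : ℝ) ^ 2 : ℝ) : ℂ) * (∑' ℓ : ℤ, FT f (2 * π * ℓ / N) *
            ((‖∑ j ∈ Finset.Icc 1 N, Complex.exp (Complex.I *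
                ((t * ℓ * N * (α * φ ((j : ℝ) / N) + β * ((j : ℝ) / N)) : ℝ) : ℂ))‖ ^ 2 : ℝ) : ℂ))
          - ((f 0 : ℂ) + FT f 0)‖ ^ 2)
        ≤ C * (Real.log N) ^ 3 / N := by
  obtain ⟨A, hA1, hA⟩ : ∃ A : ℕ, 1 ≤ A ∧ ∀ ξ : ℝ, 2 * π * A < |ξ| → FT f ξ = 0 := by
    obtain ⟨R, hR⟩ := hf.isCompact.isBounded.subset_closedBall 0
    obtain ⟨n, hn⟩ := exists_nat_ge R
    refine ⟨n + 1, by omega, fun ξ hξ => image_eq_zero_of_notMem_tsupport fun hmem => ?_⟩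
    have h1 := hR hmem
    rw [mem_closedBall_zero_iff, Real.norm_eq_abs] at h1
    push_cast at hξ
    have : (0 : ℝ) ≤ n := n.cast_nonneg
    nlinarith [Real.pi_gt_three]
  obtain ⟨K₁, hK₁, hint⟩ := exists_integral_integral_norm_sq_expSum_le t T ht hT
  obtain ⟨K₂, hK₂, hcard⟩ := card_closePairs_le_log_cube hc
    (fun x y h hx hy hxh hyh => le_abs_sub_sub_sub_of_abs_iteratedDerivWithin_ge hc hφ
      (fun z hz => (hφ'' z hz).1) hx hy hxh hyh) hA1
  obtain ⟨K₃, hK₃, herr⟩ := exists_norm_tsum_FT_sub_le f hA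
  set M : ℝ := ∫ x, ‖f x‖ with hM
  set D : ℝ := K₃ + ‖FT f 0‖ with hD
  have hD0 : 0 ≤ D := by positivity
  refine ⟨1 / (2 * T) ^ 2 * (2 * (K₁ * (M ^ 2 * K₂))) + 16 * D ^ 2, fun N hN => ?_⟩
  have hN0 : 0 < N := by omega
  have hNr : (0 : ℝ) < N := by exact_mod_cast hN0
  have hN1 : (1 : ℝ) ≤ N := by exact_mod_cast hN0
  have hlog : 1 / 2 ≤ Real.log N := by
    have h1 : Real.log 2 ≤ Real.log N := Real.log_le_log two_pos (by exact_mod_cast hN)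
    linarith [Real.log_two_gt_d9]
  have hvan : ∀ ℓ : ℤ, ((A * N : ℕ) : ℤ) < |ℓ| → FT f (2 * π * ℓ / N) = 0 := by
    intro ℓ hℓ
    apply hA
    have hℓ' : (A * N : ℝ) < |(ℓ : ℝ)| := by exact_mod_cast hℓ
    rw [abs_div, abs_mul, abs_of_pos Real.two_pi_pos, abs_of_pos hNr, lt_div_iff₀ hNr, mul_assoc]
    gcongr
  simp_rw [pairCorrelation_sub_eq hN0 hvan φ t _ _ (f 0 : ℂ)]
  set E : ℂ := (1 / N : ℂ) * ∑' ℓ : ℤ, FT f (2 * π * ℓ / N) - (f 0 : ℂ) - FT f 0 / N with hE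
  have hEn : ‖E‖ ≤ D / N := by
    refine (norm_sub_le _ _).trans ?_
    rw [hD, add_div, norm_div, Complex.norm_natCast]
    gcongr
    exact herr N hN0
  let S : ℝ → ℝ → ℂ := fun α β => ∑ i ∈ offDiagIndex (A * N) N, FT f (2 * π * i.1 / N) *
    Complex.exp (Complex.I * ((t * (α * phaseFreq φ N i + β * linearFreq i) : ℝ) : ℂ))
  have hSint : ∫ α in (-T)..T, ∫ β in (-T)..T, ‖S α β‖ ^ 2
      ≤ K₁ * (M ^ 2 * (K₂ * N ^ 3 * Real.log N ^ 3)) := by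
    refine (hint _ (offDiagIndex (A * N) N) (fun i => FT f (2 * π * i.1 / N)) (phaseFreq φ N)
      linearFreq M fun i _ => norm_FT_le f _).trans ?_
    gcongr
    exact hcard N hN
  have hpt : ∀ α β, ‖((1 / (N : ℝ) ^ 2 : ℝ) : ℂ) * S α β + E‖ ^ 2 ≤
      2 / (N : ℝ) ^ 4 * ‖S α β‖ ^ 2 + 2 * (D / N) ^ 2 := by
    intro α β
    have h1 : ‖((1 / (N : ℝ) ^ 2 : ℝ) : ℂ) * S α β‖ = 1 / (N : ℝ) ^ 2 * ‖S α β‖ := by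
      rw [norm_mul, Complex.norm_real, Real.norm_of_nonneg (by positivity)]
    calc ‖((1 / (N : ℝ) ^ 2 : ℝ) : ℂ) * S α β + E‖ ^ 2
        ≤ (1 / (N : ℝ) ^ 2 * ‖S α β‖ + D / N) ^ 2 := by
          gcongr
          exact (norm_add_le _ _).trans (add_le_add h1.le hEn)
      _ ≤ 2 * ((1 / (N : ℝ) ^ 2 * ‖S α β‖) ^ 2 + (D / N) ^ 2) := add_sq_le
      _ = _ := by ring
  have hSc : Continuous (Function.uncurry S) := by
    simp only [S, Function.uncurry_def]
    fun_prop
  have hSc' : ∀ α, Continuous (S α) := fun α => by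
    simp only [S]
    fun_prop
  have hparam : ∀ G : ℝ → ℝ → ℝ, Continuous (Function.uncurry G) →
      IntervalIntegrable (fun α => ∫ β in (-T)..T, G α β) volume (-T) T := fun G hG =>
    (intervalIntegral.continuous_parametric_intervalIntegral_of_continuous' hG _ _).intervalIntegrable
      _ _
  have hmono : ∫ α in (-T)..T, ∫ β in (-T)..T, ‖((1 / (N : ℝ) ^ 2 : ℝ) : ℂ) * S α β + E‖ ^ 2 ≤
      2 / (N : ℝ) ^ 4 * (∫ α in (-T)..T, ∫ β in (-T)..T, ‖S α β‖ ^ 2)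
        + (2 * T) ^ 2 * (2 * (D / N) ^ 2) := by
    calc _ ≤ ∫ α in (-T)..T, ∫ β in (-T)..T,
          (2 / (N : ℝ) ^ 4 * ‖S α β‖ ^ 2 + 2 * (D / N) ^ 2) := by
          refine intervalIntegral.integral_mono (by linarith) (hparam _ ?_) (hparam _ ?_)
            fun α => intervalIntegral.integral_mono (by linarith) ?_ ?_ (hpt α)
          · exact ((continuous_const.mul hSc).add continuous_const).norm.pow 2
          · exact (continuous_const.mul (hSc.norm.pow 2)).add continuous_const
          · exact (((continuous_const.mul (hSc' α)).add continuous_const).norm.pow 2)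
              |>.intervalIntegrable _ _
          · exact ((continuous_const.mul ((hSc' α).norm.pow 2)).add continuous_const)
              |>.intervalIntegrable _ _
      _ = ∫ α in (-T)..T, (2 / (N : ℝ) ^ 4 * (∫ β in (-T)..T, ‖S α β‖ ^ 2)
            + 2 * T * (2 * (D / N) ^ 2)) := by
          refine intervalIntegral.integral_congr fun α _ => ?_
          rw [intervalIntegral.integral_add, intervalIntegral.integral_const_mul,
            intervalIntegral.integral_const, smul_eq_mul]
          · ring
          · exact (continuous_const.mul ((hSc' α).norm.pow 2)).intervalIntegrable _ _
          · exact intervalIntegrable_const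
      _ = _ := by
          rw [intervalIntegral.integral_add, intervalIntegral.integral_const_mul,
            intervalIntegral.integral_const, smul_eq_mul]
          · ring
          · exact (hparam (fun α β => ‖S α β‖ ^ 2) ((continuous_pow 2).comp hSc.norm)).const_mul _
          · exact intervalIntegrable_const
  calc _ ≤ 1 / (2 * T) ^ 2 * (2 / (N : ℝ) ^ 4 * (K₁ * (M ^ 2 * (K₂ * N ^ 3 * Real.log N ^ 3)))
        + (2 * T) ^ 2 * (2 * (D / N) ^ 2)) := by
        refine mul_le_mul_of_nonneg_left (hmono.trans ?_) (by positivity)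
        gcongr
    _ = 1 / (2 * T) ^ 2 * (2 * (K₁ * (M ^ 2 * K₂))) * Real.log N ^ 3 / N
        + 2 * D ^ 2 * (1 / N) / N := by
        field_simp
    _ ≤ 1 / (2 * T) ^ 2 * (2 * (K₁ * (M ^ 2 * K₂))) * Real.log N ^ 3 / N
        + 2 * D ^ 2 * (8 * Real.log N ^ 3) / N := by
        gcongr
        calc 1 / (N : ℝ) ≤ 1 := by rw [div_le_one hNr]; exact hN1
          _ = 8 * (1 / 2) ^ 3 := by norm_num
          _ ≤ _ := by gcongr
    _ = _ := by ring
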